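/- Let μ be a trigonometric polynomial and let g ∈ L¹([0,1]²) satisfy μ∇g = 0 in the distributional sense. Then for every connected component U of the open set (0,1)² ∖ {r : μ(r) = 0} there exists a constant b_U ∈ ℂ such that g = b_U almost everywhere on U; consequently, g agrees almost everywhere on [0,1]² with a piecewise constant function Σ_i b_i 1_{U_i}, where the U_i are the connected components of (0,1)² ∖ {μ = 0}. -/

import Mathlib

open MeasureTheory Set
open scoped Pointwise

noncomputable section

/-- The unit square `[0,1]²`. -/
def box : Set (ℝ × ℝ) := Set.Icc (0:ℝ) 1 ×ˢ Set.Icc (0:ℝ) 1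

/-- The complex exponential `e^{2πi k·r}` with integer frequency `k`. -/
def e2 (k : ℤ × ℤ) (r : ℝ × ℝ) : ℂ :=
  Complex.exp (2 * Real.pi * Complex.I * ((k.1 : ℂ) * (r.1 : ℂ) + (k.2 : ℂ) * (r.2 : ℂ)))

/-- The trigonometric sum with coefficient support `Λ` and coefficients `c`. -/
def trigSum (Λ : Finset (ℤ × ℤ)) (c : ℤ × ℤ → ℂ) : (ℝ × ℝ) → ℂ :=
  fun r => ∑ k ∈ Λ, c k * e2 k r

/-- The Fourier coefficient `f̂[m] = ∫_{[0,1]²} f(r) e^{-2πi m·r} dr`. -/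
def fourierCoeff2 (f : ℝ × ℝ → ℂ) (m : ℤ × ℤ) : ℂ :=
  ∫ r in box, f r * Complex.exp (-(2 * Real.pi * Complex.I *
    ((m.1 : ℂ) * (r.1 : ℂ) + (m.2 : ℂ) * (r.2 : ℂ))))

/-- `d` (supported on `Λ`) satisfies the annihilation equation for `f` at `ℓ`:
`∑_{k ∈ Λ} d[k] ⋅ 2πi (ℓ-k)_x ⋅ f̂[ℓ-k] = 0` and likewise for the `y`-component. -/
def Annihilates (Λ : Finset (ℤ × ℤ)) (d : ℤ × ℤ → ℂ) (f : ℝ × ℝ → ℂ) (ℓ : ℤ × ℤ) : Prop :=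
  (∑ k ∈ Λ, d k * (2 * Real.pi * Complex.I * (((ℓ - k).1 : ℂ))) * fourierCoeff2 f (ℓ - k)) = 0 ∧
  (∑ k ∈ Λ, d k * (2 * Real.pi * Complex.I * (((ℓ - k).2 : ℂ))) * fourierCoeff2 f (ℓ - k)) = 0

/-- `μ` is a (integer-frequency) trigonometric polynomial: a nonzero finite sum
`∑_{k ∈ Λ} c[k] e^{2πi k·r}`. -/
def IsTrigPolyFn (μ : ℝ × ℝ → ℂ) : Prop :=
  (∃ (Λ : Finset (ℤ × ℤ)) (c : ℤ × ℤ → ℂ), μ = trigSum Λ c) ∧ μ ≠ 0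

/-- The zero set of `μ` in `[0,1]²`. -/
def zeroSetOn (μ : ℝ × ℝ → ℂ) : Set (ℝ × ℝ) := {r | r ∈ box ∧ μ r = 0}

/-- `γ` divides `μ` among trigonometric polynomials. -/
def TrigDivides (γ μ : ℝ × ℝ → ℂ) : Prop :=
  ∃ η : ℝ × ℝ → ℂ, IsTrigPolyFn η ∧ μ = fun r => γ r * η r

/-- `C` is a trigonometric curve: the zero set in `[0,1]²` of a trigonometric polynomial,
infinite and with no isolated points. -/
def IsTrigCurve (C : Set (ℝ × ℝ)) : Prop :=
  (∃ μ : ℝ × ℝ → ℂ, IsTrigPolyFn μ ∧ C = zeroSetOn μ) ∧ C.Infinite ∧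
    ∀ x ∈ C, AccPt x (Filter.principal C)

/-- `μ` is a minimal polynomial of the trigonometric curve `C`: a real-valued
trigonometric polynomial whose zero set in `[0,1]²` is `C` and which divides every
trigonometric polynomial vanishing on `C`. -/
def IsMinPoly (μ : ℝ × ℝ → ℂ) (C : Set (ℝ × ℝ)) : Prop :=
  IsTrigPolyFn μ ∧ (∀ r, (μ r).im = 0) ∧ C = zeroSetOn μ ∧
    ∀ ν : ℝ × ℝ → ℂ, IsTrigPolyFn ν → (∀ r ∈ C, ν r = 0) → TrigDivides μ ν

/-- The contraction `Λ' ⊖ Λ = {ℓ : ℓ + k ∈ Λ' for all k ∈ Λ}` (as a finset; for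
nonempty `Λ` this agrees with the set-theoretic contraction). -/
def shrink (Λ' Λ : Finset (ℤ × ℤ)) : Finset (ℤ × ℤ) :=
  (Λ' - Λ).filter fun ℓ => ∀ k ∈ Λ, ℓ + k ∈ Λ'

/-- A `C^∞` function `ℝ² → ℂ` that is 1-periodic in each variable. -/
def SmoothPeriodic (ψ : ℝ × ℝ → ℂ) : Prop :=
  ContDiff ℝ (⊤ : ℕ∞) ψ ∧ (∀ r : ℝ × ℝ, ψ (r.1 + 1, r.2) = ψ r) ∧
    (∀ r : ℝ × ℝ, ψ (r.1, r.2 + 1) = ψ r)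

/-- Partial derivative in the `x` direction. -/
def pderivX (F : ℝ × ℝ → ℂ) (r : ℝ × ℝ) : ℂ := fderiv ℝ F r (1, 0)

/-- Partial derivative in the `y` direction. -/
def pderivY (F : ℝ × ℝ → ℂ) (r : ℝ × ℝ) : ℂ := fderiv ℝ F r (0, 1)

/-- `μ ∇g = 0` in the distributional sense: for all smooth periodic test functions
`ψ₁, ψ₂`, `∫_{[0,1]²} g(r) [∂ₓ(μψ₁)(r) + ∂_y(μψ₂)(r)] dr = 0`. -/
def MuGradZero (μ g : ℝ × ℝ → ℂ) : Prop :=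
  ∀ ψ₁ ψ₂ : ℝ × ℝ → ℂ, SmoothPeriodic ψ₁ → SmoothPeriodic ψ₂ →
    (∫ r in box, g r * (pderivX (fun s => μ s * ψ₁ s) r
      + pderivY (fun s => μ s * ψ₂ s) r)) = 0

open Filter Topology in
lemma eventually_floor_eq_of_fract_pos {x : ℝ} (hx : 0 < Int.fract x) :
    ∀ᶠ s in 𝓝 x, ⌊s⌋ = ⌊x⌋ := by
  have h : Set.Ioo (⌊x⌋ : ℝ) (⌊x⌋ + 1) ∈ 𝓝 x :=
    Ioo_mem_nhds (by rw [Int.fract] at hx; linarith) (Int.lt_floor_add_one x)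
  filter_upwards [h] with s hs
  exact Int.floor_eq_iff.2 ⟨hs.1.le, hs.2⟩

open Filter Topology in
lemma eventually_fract_notMem_Icc {x a b : ℝ} (hx : Int.fract x = 0) (ha : 0 < a) (hb : b < 1) :
    ∀ᶠ s in 𝓝 x, Int.fract s ∉ Set.Icc a b := by
  have hx' : x = ⌊x⌋ := by rw [Int.fract] at hx; linarith
  have h : Set.Ioo (x - min (1 - b) 1) (x + min a 1) ∈ 𝓝 x := by
    apply Ioo_mem_nhds
    · linarith [lt_min (sub_pos.2 hb) one_pos]
    · linarith [lt_min ha one_pos]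
  filter_upwards [h] with s hs hs'
  have h₁ := min_le_left (1 - b) 1
  have h₂ := min_le_right (1 - b) 1
  have h₃ := min_le_left a 1
  have h₄ := min_le_right a 1
  rw [Int.fract] at hs'
  rcases le_or_gt x s with h | h
  · have : ⌊s⌋ = ⌊x⌋ := Int.floor_eq_iff.2 ⟨by linarith, by linarith [hs.2]⟩
    rw [this] at hs'
    linarith [hs.2, hs'.1]
  · have : ⌊s⌋ = ⌊x⌋ - 1 :=
      Int.floor_eq_iff.2 ⟨by push_cast; linarith [hs.1], by push_cast; linarith⟩
    rw [this] at hs'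
    push_cast at hs'
    linarith [hs.1, hs'.2]

lemma IsCompact.exists_subset_Icc_of_subset_Ioo {K : Set ℝ} {l u : ℝ} (hK : IsCompact K)
    (h : K ⊆ Set.Ioo l u) : ∃ a b, l < a ∧ b < u ∧ K ⊆ Set.Icc a b := by
  rcases K.eq_empty_or_nonempty with rfl | hne
  · exact ⟨l + 1, u - 1, by linarith, by linarith, Set.empty_subset _⟩
  · exact ⟨sInf K, sSup K, (h (hK.sInf_mem hne)).1, (h (hK.sSup_mem hne)).2,
      fun x hx => ⟨csInf_le hK.bddBelow hx, le_csSup hK.bddAbove hx⟩⟩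

/-- The 1-periodic extension of the restriction of `ψ` to `[0,1)²`. -/
def periodize (ψ : ℝ × ℝ → ℂ) (r : ℝ × ℝ) : ℂ := ψ (Int.fract r.1, Int.fract r.2)

lemma periodize_of_mem {ψ : ℝ × ℝ → ℂ} {r : ℝ × ℝ}
    (hr : r ∈ Set.Ioo (0:ℝ) 1 ×ˢ Set.Ioo (0:ℝ) 1) : periodize ψ r = ψ r := by
  rw [periodize, Int.fract_eq_self.2 ⟨hr.1.1.le, hr.1.2⟩, Int.fract_eq_self.2 ⟨hr.2.1.le, hr.2.2⟩]

open Filter Topology in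
lemma smoothPeriodic_periodize {ψ : ℝ × ℝ → ℂ} (hψ : ContDiff ℝ (⊤ : ℕ∞) ψ)
    (hc : HasCompactSupport ψ) (hs : tsupport ψ ⊆ Set.Ioo (0:ℝ) 1 ×ˢ Set.Ioo (0:ℝ) 1) :
    SmoothPeriodic (periodize ψ) := by
  refine ⟨contDiff_iff_contDiffAt.2 fun r => ?_, fun r => by simp [periodize],
    fun r => by simp [periodize]⟩
  obtain ⟨a, b, ha, hb, hab⟩ := (hc.isCompact.image continuous_fst).exists_subset_Icc_of_subset_Ioo
    (l := 0) (u := 1) (by rintro _ ⟨p, hp, rfl⟩; exact (hs hp).1)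
  obtain ⟨c, d, hc', hd, hcd⟩ :=
    (hc.isCompact.image continuous_snd).exists_subset_Icc_of_subset_Ioo
      (l := 0) (u := 1) (by rintro _ ⟨p, hp, rfl⟩; exact (hs hp).2)
  have hzero₁ : ∀ x y, x ∉ Set.Icc a b → ψ (x, y) = 0 := fun x y hx => by
    by_contra h
    exact hx (hab ⟨(x, y), subset_tsupport _ h, rfl⟩)
  have hzero₂ : ∀ x y, y ∉ Set.Icc c d → ψ (x, y) = 0 := fun x y hy => by
    by_contra h
    exact hy (hcd ⟨(x, y), subset_tsupport _ h, rfl⟩)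
  have tfst : Tendsto Prod.fst (𝓝 r) (𝓝 r.1) := continuous_fst.tendsto r
  have tsnd : Tendsto Prod.snd (𝓝 r) (𝓝 r.2) := continuous_snd.tendsto r
  rcases (Int.fract_nonneg r.1).eq_or_lt with h₁ | h₁
  · refine (contDiffAt_const (c := (0 : ℂ))).congr_of_eventuallyEq ?_
    filter_upwards [tfst.eventually (eventually_fract_notMem_Icc h₁.symm ha hb)] with s hs
    exact hzero₁ _ _ hs
  rcases (Int.fract_nonneg r.2).eq_or_lt with h₂ | h₂
  · refine (contDiffAt_const (c := (0 : ℂ))).congr_of_eventuallyEq ?_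
    filter_upwards [tsnd.eventually (eventually_fract_notMem_Icc h₂.symm hc' hd)] with s hs
    exact hzero₂ _ _ hs
  have : ContDiff ℝ (⊤ : ℕ∞) fun s : ℝ × ℝ => ψ (s.1 - ⌊r.1⌋, s.2 - ⌊r.2⌋) := by fun_prop
  refine this.contDiffAt.congr_of_eventuallyEq ?_
  filter_upwards [tfst.eventually (eventually_floor_eq_of_fract_pos h₁),
    tsnd.eventually (eventually_floor_eq_of_fract_pos h₂)] with s hs₁ hs₂
  simp only [periodize, Int.fract, hs₁, hs₂]

lemma contDiff_trigSum (Λ : Finset (ℤ × ℤ)) (c : ℤ × ℤ → ℂ) {n : WithTop ℕ∞} :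
    ContDiff ℝ n (trigSum Λ c) := by
  have h : ∀ f : ℝ × ℝ → ℝ, ContDiff ℝ n f → ContDiff ℝ n fun r => (f r : ℂ) :=
    fun f hf => Complex.ofRealCLM.contDiff.comp hf
  have h₁ := h _ contDiff_fst
  have h₂ := h _ contDiff_snd
  unfold trigSum e2
  fun_prop

lemma volume_setOf_eq_zero_of_analyticOnNhd {f : ℝ → ℂ} (hf : AnalyticOnNhd ℝ f Set.univ) {x : ℝ}
    (hx : f x ≠ 0) : volume {y | f y = 0} = 0 := by
  have h := ae_restrict_le_codiscreteWithin (μ := (volume : Measure ℝ)) MeasurableSet.univ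
    (hf.preimage_zero_mem_codiscrete hx)
  rw [Measure.restrict_univ] at h
  simpa [mem_ae_iff, Set.preimage, Set.compl_def] using h

/-- The zero set of a trigonometric polynomial is Lebesgue-null. -/
lemma IsTrigPolyFn.volume_zeros {μ : ℝ × ℝ → ℂ} (hμ : IsTrigPolyFn μ) :
    volume {r | μ r = 0} = 0 := by
  obtain ⟨⟨Λ, c, rfl⟩, hne⟩ := hμ
  obtain ⟨⟨x₀, y₀⟩, h₀⟩ := Function.ne_iff.1 hne
  have hsm : ContDiff ℝ ⊤ (trigSum Λ c) := contDiff_trigSum Λ c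
  have han₁ : ∀ y, AnalyticOnNhd ℝ (fun x => trigSum Λ c (x, y)) Set.univ := fun y x _ =>
    (hsm.comp (contDiff_id.prodMk contDiff_const)).contDiffAt.analyticAt
  have han₂ : ∀ x, AnalyticOnNhd ℝ (fun y => trigSum Λ c (x, y)) Set.univ := fun x y _ =>
    (hsm.comp (contDiff_const.prodMk contDiff_id)).contDiffAt.analyticAt
  have hclosed : IsClosed {r | trigSum Λ c r = 0} :=
    isClosed_eq hsm.continuous continuous_const
  rw [Measure.volume_eq_prod, Measure.measure_prod_null hclosed.measurableSet]
  have hx : ∀ᵐ x : ℝ, trigSum Λ c (x, y₀) ≠ 0 := by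
    simpa [ae_iff] using volume_setOf_eq_zero_of_analyticOnNhd (han₁ y₀) h₀
  filter_upwards [hx] with x hx
  exact volume_setOf_eq_zero_of_analyticOnNhd (han₂ x) hx

/-- A sequence of bump functions at the origin whose supports shrink to a point. -/
def shrinkingBump {E : Type*} [NormedAddCommGroup E] (n : ℕ) : ContDiffBump (0 : E) where
  rIn := 1 / (n + 1)
  rOut := 2 / (n + 1)
  rIn_pos := by positivity
  rIn_lt_rOut := by gcongr; norm_num

open Filter Topology in
lemma tendsto_shrinkingBump_rOut {E : Type*} [NormedAddCommGroup E] :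
    Tendsto (fun n => (shrinkingBump n : ContDiffBump (0 : E)).rOut) atTop (𝓝 0) := by
  have := (tendsto_one_div_add_atTop_nhds_zero_nat (𝕜 := ℝ)).const_mul 2
  simpa [shrinkingBump, div_eq_mul_inv] using this

section

variable {E : Type*} [NormedAddCommGroup E] [NormedSpace ℝ E] [FiniteDimensional ℝ E]
  [MeasurableSpace E] [BorelSpace E]

/-- `f` has vanishing distributional gradient on `W`. -/
def HasZeroGradientOn (f : E → ℂ) (W : Set E) (ν : Measure E) : Prop :=
  ∀ φ : E → ℂ, ContDiff ℝ (⊤ : ℕ∞) φ → HasCompactSupport φ → tsupport φ ⊆ W →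
    ∀ v, ∫ t, f t * fderiv ℝ φ t v ∂ν = 0

variable {f : E → ℂ} {W : Set E} {ν : Measure E} [ν.IsAddHaarMeasure]

open ContinuousLinearMap Convolution in
lemma HasZeroGradientOn.hasFDerivAt_convolution (hW : HasZeroGradientOn f W ν)
    (hf : LocallyIntegrable f ν) {ρ : E → ℝ} (hρ : ContDiff ℝ (⊤ : ℕ∞) ρ)
    (hρc : HasCompactSupport ρ) {x : E} (hx : ∀ t ∈ tsupport ρ, x - t ∈ W) :
    HasFDerivAt (ρ ⋆[lsmul ℝ ℝ, ν] f) (0 : E →L[ℝ] ℂ) x := by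
  have key := hρc.hasFDerivAt_convolution_left (lsmul ℝ ℝ) (hρ.of_le (by simp)) hf x
  suffices h : (fderiv ℝ ρ ⋆[(lsmul ℝ ℝ : ℝ →L[ℝ] ℂ →L[ℝ] ℂ).precompL E, ν] f) x = 0 by
    rwa [h] at key
  ext v
  have hex := (hρc.fderiv ℝ).convolutionExists_left ((lsmul ℝ ℝ : ℝ →L[ℝ] ℂ →L[ℝ] ℂ).precompL E)
    (hρ.continuous_fderiv (by simp)) hf x
  have hcont : Continuous fun t : E => x - t := by fun_prop
  let φ : E → ℂ := fun t => (ρ (x - t) : ℂ)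
  have hφ : ContDiff ℝ (⊤ : ℕ∞) φ := Complex.ofRealCLM.contDiff.comp (hρ.comp (by fun_prop))
  have hts : tsupport φ ⊆ (fun t => x - t) ⁻¹' tsupport ρ := by
    refine closure_minimal (fun t ht => subset_tsupport _ ?_)
      ((isClosed_tsupport ρ).preimage hcont)
    simpa [φ] using ht
  have hφc : HasCompactSupport φ := by
    refine (hρc.isCompact.image hcont).of_isClosed_subset (isClosed_tsupport φ) fun t ht => ?_
    exact ⟨x - t, hts ht, by simp⟩
  have hderiv : ∀ t, fderiv ℝ φ t v = -(fderiv ℝ ρ (x - t) v : ℂ) := fun t => by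
    have h₁ : HasFDerivAt ρ (fderiv ℝ ρ (x - t)) (x - t) :=
      (hρ.differentiable (by simp) _).hasFDerivAt
    have h₂ : HasFDerivAt (fun t : E => x - t) (-ContinuousLinearMap.id ℝ E) t :=
      (hasFDerivAt_id t).const_sub x
    have h₃ := Complex.ofRealCLM.hasFDerivAt.comp t (h₁.comp t h₂)
    rw [show fderiv ℝ φ t = _ from h₃.fderiv]
    simp
  have hzero := hW φ hφ hφc (fun t ht => by simpa using hx _ (hts ht)) v
  have hintegrable := hex.integrable_swap
  rw [convolution_eq_swap, ContinuousLinearMap.integral_apply hintegrable]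
  simp only [hderiv, mul_neg, integral_neg, neg_eq_zero] at hzero
  rw [zero_apply, ← hzero]
  refine integral_congr_ae (.of_forall fun t => ?_)
  simp [mul_comm]

open ContinuousLinearMap Convolution Filter Topology in
/-- **Du Bois-Reymond lemma**: a locally integrable function with vanishing distributional gradient
on an open set agrees almost everywhere there with a locally constant function. -/
lemma HasZeroGradientOn.exists_locally_constant (hW : HasZeroGradientOn f W ν) (hWo : IsOpen W)
    (hf : LocallyIntegrable f ν) :
    ∃ G : E → ℂ, (∀ z ∈ W, ∀ᶠ y in 𝓝 z, G y = G z) ∧ ∀ᵐ x ∂ν, x ∈ W → f x = G x := by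
  let ρ : ℕ → ContDiffBump (0 : E) := shrinkingBump
  have hρ : Tendsto (fun n => (ρ n).rOut) atTop (𝓝 0) := tendsto_shrinkingBump_rOut
  have hae : ∀ᵐ x ∂ν, Tendsto (fun n => ((ρ n).normed ν ⋆[lsmul ℝ ℝ, ν] f) x) atTop (𝓝 (f x)) := by
    refine ContDiffBump.ae_convolution_tendsto_right_of_locallyIntegrable (K := 2) hρ
      (.of_forall fun n => ?_) hf
    simp [ρ, shrinkingBump, div_eq_mul_inv]
  set A := {x | Tendsto (fun n => ((ρ n).normed ν ⋆[lsmul ℝ ℝ, ν] f) x) atTop (𝓝 (f x))} with hA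
  have hdense : Dense A := Measure.dense_of_ae hae
  have hloc : ∀ z ∈ W, ∃ c, ∀ᶠ y in 𝓝 z, y ∈ A → f y = c := by
    intro z hz
    obtain ⟨δ, hδ, hball⟩ := Metric.isOpen_iff.1 hWo z hz
    have hB : Metric.ball z (δ / 2) ∈ 𝓝 z := Metric.ball_mem_nhds z (half_pos hδ)
    obtain ⟨a, haA, haB⟩ := hdense.exists_mem_open Metric.isOpen_ball
      ⟨z, Metric.mem_ball_self (half_pos hδ)⟩
    refine ⟨f a, ?_⟩
    filter_upwards [hB] with y hyB hyA
    refine tendsto_nhds_unique (hyA : Tendsto _ _ _) (Tendsto.congr' ?_ (haA : Tendsto _ _ _))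
    filter_upwards [hρ.eventually (gt_mem_nhds (half_pos hδ))] with n hn
    have hd : ∀ x ∈ Metric.ball z (δ / 2),
        HasFDerivAt ((ρ n).normed ν ⋆[lsmul ℝ ℝ, ν] f) (0 : E →L[ℝ] ℂ) x := by
      intro x hx
      refine hW.hasFDerivAt_convolution hf (ρ n).contDiff_normed (ρ n).hasCompactSupport_normed
        fun t ht => hball ?_
      rw [ContDiffBump.tsupport_normed_eq, mem_closedBall_zero_iff] at ht
      rw [mem_ball_iff_norm] at hx ⊢
      calc ‖x - t - z‖ = ‖(x - z) - t‖ := by congr 1; abel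
        _ ≤ ‖x - z‖ + ‖t‖ := norm_sub_le _ _
        _ < δ := by linarith
    exact Metric.isOpen_ball.is_const_of_fderiv_eq_zero (𝕜 := ℝ)
      (convex_ball z _).isPreconnected
      (fun x hx => (hd x hx).differentiableAt.differentiableWithinAt)
      (fun x hx => (hd x hx).fderiv) haB hyB
  choose! G hG using hloc
  refine ⟨G, fun z hz => ?_, ?_⟩
  · filter_upwards [(hG z hz).eventually_nhds, hWo.mem_nhds hz] with y hy hyW
    obtain ⟨w, hwA, h₁, h₂⟩ :=
      ((mem_closure_iff_frequently.1 (hdense y)).and_eventually (hy.and (hG y hyW))).exists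
    rw [← h₂ hwA, h₁ hwA]
  · filter_upwards [hae] with x hx hxW
    exact (hG x hxW).self_of_nhds hx

end

open Filter Topology in
lemma IsPreconnected.eq_of_locally_constant {X Y : Type*} [TopologicalSpace X] {U : Set X}
    (hU : IsPreconnected U) {G : X → Y} (hG : ∀ z ∈ U, ∀ᶠ y in 𝓝 z, G y = G z) {x y : X}
    (hx : x ∈ U) (hy : y ∈ U) : G x = G y :=
  hU.induction₂ (fun x y => G x = G y)
    (fun z hz => ((hG z hz).filter_mono nhdsWithin_le_nhds).mono fun _ h => h.symm)
    (fun _ _ _ _ _ _ => Eq.trans) (fun _ _ _ _ => Eq.symm) hx hy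

lemma measurableSet_box : MeasurableSet box := measurableSet_Icc.prod measurableSet_Icc

lemma openBox_ae_eq_box : Set.Ioo (0:ℝ) 1 ×ˢ Set.Ioo (0:ℝ) 1 =ᵐ[volume] box := by
  rw [Measure.volume_eq_prod]
  exact Measure.set_prod_ae_eq Ioo_ae_eq_Icc Ioo_ae_eq_Icc

lemma hasZeroGradientOn_of_muGradZero {μ g : ℝ × ℝ → ℂ} (hsm : ContDiff ℝ (⊤ : ℕ∞) μ)
    (hg : IntegrableOn g box) (hann : MuGradZero μ g) :
    HasZeroGradientOn (box.indicator g)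
      ((Set.Ioo (0:ℝ) 1 ×ˢ Set.Ioo (0:ℝ) 1) \ {r | μ r = 0}) volume := by
  intro φ hφ hφc hφs v
  let ψ : ℝ × ℝ → ℂ := fun r => φ r * (μ r)⁻¹
  have hts : tsupport ψ ⊆ tsupport φ := tsupport_mul_subset_left
  have hψ : ContDiff ℝ (⊤ : ℕ∞) ψ := contDiff_iff_contDiffAt.2 fun r => by
    by_cases hr : r ∈ tsupport φ
    · exact hφ.contDiffAt.mul (hsm.contDiffAt.inv (hφs hr).2)
    · refine (contDiffAt_const (c := (0 : ℂ))).congr_of_eventuallyEq ?_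
      exact notMem_tsupport_iff_eventuallyEq.1 fun h => hr (hts h)
  have hψc : HasCompactSupport ψ := hφc.mul_right
  have hP : SmoothPeriodic (periodize ψ) :=
    smoothPeriodic_periodize hψ hψc fun r hr => (hφs (hts hr)).1
  have h0 : SmoothPeriodic fun _ => 0 := ⟨contDiff_const, fun _ => rfl, fun _ => rfl⟩
  have hopen : IsOpen (Set.Ioo (0:ℝ) 1 ×ˢ Set.Ioo (0:ℝ) 1) := isOpen_Ioo.prod isOpen_Ioo
  have hmem : ∀ᵐ r ∂volume.restrict box, r ∈ Set.Ioo (0:ℝ) 1 ×ˢ Set.Ioo (0:ℝ) 1 := by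
    rw [← Measure.restrict_congr_set openBox_ae_eq_box]
    exact ae_restrict_mem hopen.measurableSet
  have hfd : ∀ r ∈ Set.Ioo (0:ℝ) 1 ×ˢ Set.Ioo (0:ℝ) 1,
      fderiv ℝ (fun s => μ s * periodize ψ s) r = fderiv ℝ φ r := fun r hr => by
    refine Filter.EventuallyEq.fderiv_eq ?_
    filter_upwards [hopen.mem_nhds hr] with s hs
    rw [periodize_of_mem hs]
    by_cases h : μ s = 0
    · rw [h, zero_mul, image_eq_zero_of_notMem_tsupport fun h' => (hφs h').2 h]
    · simp only [ψ]
      field_simp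
  have hcont : Continuous (fderiv ℝ φ) := hφ.continuous_fderiv (by simp)
  have hintegrable : ∀ w, IntegrableOn (fun r => g r * fderiv ℝ φ r w) box := fun w => by
    have hb : HasCompactSupport fun r => fderiv ℝ φ r w := hφc.fderiv_apply ℝ w
    obtain ⟨C, hC⟩ := (hcont.clm_apply continuous_const).bounded_above_of_compact_support hb
    exact hg.mul_bdd (hcont.clm_apply continuous_const).aestronglyMeasurable (.of_forall hC)
  have hX : ∫ r in box, g r * fderiv ℝ φ r (1, 0) = 0 := by
    rw [← hann _ _ hP h0]
    refine integral_congr_ae ?_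
    filter_upwards [hmem] with r hr
    simp [pderivX, pderivY, hfd r hr]
  have hY : ∫ r in box, g r * fderiv ℝ φ r (0, 1) = 0 := by
    rw [← hann _ _ h0 hP]
    refine integral_congr_ae ?_
    filter_upwards [hmem] with r hr
    simp [pderivX, pderivY, hfd r hr]
  have hv : ∀ r, g r * fderiv ℝ φ r v
      = v.1 * (g r * fderiv ℝ φ r (1, 0)) + v.2 * (g r * fderiv ℝ φ r (0, 1)) := fun r => by
    have : v = v.1 • ((1, 0) : ℝ × ℝ) + v.2 • ((0, 1) : ℝ × ℝ) := by ext <;> simp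
    conv_lhs => rw [this, map_add, map_smul, map_smul]
    simp only [Complex.real_smul]
    ring
  have hind : ∀ r, box.indicator g r * fderiv ℝ φ r v
      = box.indicator (fun r => g r * fderiv ℝ φ r v) r := fun r => by
    by_cases h : r ∈ box <;> simp [h]
  simp_rw [hind]
  rw [integral_indicator measurableSet_box]
  simp_rw [hv]
  rw [integral_add ((hintegrable _).const_mul _) ((hintegrable _).const_mul _), integral_const_mul,
    integral_const_mul, hX, hY]
  simp

/-- If `μ` is a trigonometric polynomial and `g ∈ L¹([0,1]²)` satisfies
`μ∇g = 0` distributionally, then `g` is a.e. constant on each connected component of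
`(0,1)² \ {μ = 0}`, and consequently `g` agrees a.e. on `[0,1]²` with a function that is
constant on each such component and zero elsewhere. -/
theorem stmt7 (μ : ℝ × ℝ → ℂ) (hμ : IsTrigPolyFn μ)
    (g : ℝ × ℝ → ℂ) (hg : IntegrableOn g box)
    (hann : MuGradZero μ g) :
    (∀ x ∈ (Set.Ioo (0:ℝ) 1 ×ˢ Set.Ioo (0:ℝ) 1) \ {r | μ r = 0},
      ∃ b : ℂ, ∀ᵐ r ∂(volume.restrict (connectedComponentIn
        ((Set.Ioo (0:ℝ) 1 ×ˢ Set.Ioo (0:ℝ) 1) \ {r | μ r = 0}) x)), g r = b) ∧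
    (∃ h : ℝ × ℝ → ℂ,
      (∀ x ∈ (Set.Ioo (0:ℝ) 1 ×ˢ Set.Ioo (0:ℝ) 1) \ {r | μ r = 0},
        ∀ y ∈ connectedComponentIn
          ((Set.Ioo (0:ℝ) 1 ×ˢ Set.Ioo (0:ℝ) 1) \ {r | μ r = 0}) x, h y = h x) ∧
      (∀ r ∉ (Set.Ioo (0:ℝ) 1 ×ˢ Set.Ioo (0:ℝ) 1) \ {r | μ r = 0}, h r = 0) ∧
      (∀ᵐ r ∂(volume.restrict box), g r = h r)) := by
  have hsm : ContDiff ℝ (⊤ : ℕ∞) μ := by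
    obtain ⟨⟨Λ, c, rfl⟩, -⟩ := hμ
    exact contDiff_trigSum Λ c
  have hzero : ∀ᵐ r, μ r ≠ 0 := by simpa [ae_iff] using hμ.volume_zeros
  have hgrad := hasZeroGradientOn_of_muGradZero hsm hg hann
  set W := (Set.Ioo (0:ℝ) 1 ×ˢ Set.Ioo (0:ℝ) 1) \ {r | μ r = 0} with hW
  have hWo : IsOpen W :=
    (isOpen_Ioo.prod isOpen_Ioo).sdiff (isClosed_eq hsm.continuous continuous_const)
  have hWbox : W ⊆ box := sdiff_subset.trans (prod_mono Ioo_subset_Icc_self Ioo_subset_Icc_self)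
  obtain ⟨G, hG, hfG⟩ := hgrad.exists_locally_constant hWo
    (hg.integrable_indicator measurableSet_box).locallyIntegrable
  have hgG : ∀ᵐ r, r ∈ W → g r = G r := by
    filter_upwards [hfG] with r hr hrW
    rw [← hr hrW, indicator_of_mem (hWbox hrW)]
  have hconst : ∀ x ∈ W, ∀ y ∈ connectedComponentIn W x, G y = G x := fun x hx y hy =>
    isPreconnected_connectedComponentIn.eq_of_locally_constant
      (fun z hz => hG z (connectedComponentIn_subset W x hz)) hy (mem_connectedComponentIn hx)
  refine ⟨fun x hx => ⟨G x, ?_⟩, W.indicator G, fun x hx y hy => ?_,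
    fun r hr => indicator_of_notMem hr G, ?_⟩
  · rw [ae_restrict_iff' hWo.connectedComponentIn.measurableSet]
    filter_upwards [hgG] with r hr hrU
    rw [hr (connectedComponentIn_subset W x hrU), hconst x hx r hrU]
  · rw [indicator_of_mem hx, indicator_of_mem (connectedComponentIn_subset W x hy),
      hconst x hx y hy]
  · rw [ae_restrict_iff' measurableSet_box]
    filter_upwards [hgG, hzero, openBox_ae_eq_box.mem_iff] with r hr hrμ hiff hrbox
    have hrW : r ∈ W := ⟨hiff.2 hrbox, hrμ⟩
    rw [indicator_of_mem hrW, hr hrW]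

end
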